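/- Let P be an n×n partial permutation matrix. Then the stratum E_P = {(X,Y) ∈ Mₙ(ℂ)² : X ∈ B₊PB₊ and XY, YX are both upper triangular} is irreducible; that is, its vanishing ideal 𝕀(E_P) ⊆ R is a prime ideal. -/

import Mathlib

noncomputable section

/-- Pairs of `n × n` complex matrices are points of `ℂ^{2n²}`. -/
abbrev MatC (n : ℕ) := Matrix (Fin n) (Fin n) ℂ

/-- The polynomial ring `R = ℂ[x_{ij}, y_{ij}]` in `2n²` variables. -/
abbrev PolyRing (n : ℕ) := MvPolynomial ((Fin n × Fin n) ⊕ (Fin n × Fin n)) ℂ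

/-- Evaluation of a polynomial at a point `(X, Y)` of `ℂ^{2n²}`. -/
def evalPt (n : ℕ) (p : MatC n × MatC n) : PolyRing n →+* ℂ :=
  MvPolynomial.eval (Sum.elim (fun q => p.1 q.1 q.2) (fun q => p.2 q.1 q.2))

/-- The vanishing ideal `𝕀(S)` of a subset `S ⊆ ℂ^{2n²}`. -/
def vanishingIdeal (n : ℕ) (S : Set (MatC n × MatC n)) : Ideal (PolyRing n) :=
  ⨅ p ∈ S, RingHom.ker (evalPt n p)

/-- `M` is upper triangular: `M_{ij} = 0` for `i > j`. -/
def IsUpperTri {n : ℕ} (M : MatC n) : Prop := ∀ i j : Fin n, j < i → M i j = 0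

/-- `P` is a partial permutation matrix: a 0,1-matrix with at most one 1 in
each row and column. -/
def IsPartialPermMat {n : ℕ} (P : MatC n) : Prop :=
  (∀ i j : Fin n, P i j = 0 ∨ P i j = 1) ∧
  (∀ i j k : Fin n, P i j = 1 → P i k = 1 → j = k) ∧
  (∀ i j k : Fin n, P i j = 1 → P k j = 1 → i = k)

/-- The stratum `E_P = {(X,Y) : X ∈ B₊PB₊, XY and YX upper triangular}`. -/
def EP {n : ℕ} (P : MatC n) : Set (MatC n × MatC n) :=
  { p | (∃ B₁ B₂ : MatC n, IsUnit B₁ ∧ IsUpperTri B₁ ∧ IsUnit B₂ ∧ IsUpperTri B₂ ∧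
          p.1 = B₁ * P * B₂) ∧
        IsUpperTri (p.1 * p.2) ∧ IsUpperTri (p.2 * p.1) }

theorem isUpperTri_iff_blockTriangular {n : ℕ} {M : MatC n} :
    IsUpperTri M ↔ M.BlockTriangular id :=
  ⟨fun h _ _ hij => h _ _ hij, fun h _ _ hij => h hij⟩

namespace IsUpperTri

variable {n : ℕ} {M N : MatC n}

theorem zero : IsUpperTri (0 : MatC n) := fun _ _ _ => rfl

theorem one : IsUpperTri (1 : MatC n) :=
  isUpperTri_iff_blockTriangular.2 Matrix.blockTriangular_one

theorem mul (hM : IsUpperTri M) (hN : IsUpperTri N) : IsUpperTri (M * N) :=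
  isUpperTri_iff_blockTriangular.2 <|
    (isUpperTri_iff_blockTriangular.1 hM).mul (isUpperTri_iff_blockTriangular.1 hN)

theorem add (hM : IsUpperTri M) (hN : IsUpperTri N) : IsUpperTri (M + N) := fun i j hij => by
  simp [hM i j hij, hN i j hij]

theorem smul (c : ℂ) (hM : IsUpperTri M) : IsUpperTri (c • M) := fun i j hij => by
  simp [hM i j hij]

theorem inv (hM : IsUpperTri M) (hu : IsUnit M) : IsUpperTri M⁻¹ := by
  have := hu.invertible
  exact isUpperTri_iff_blockTriangular.2 <|
    Matrix.blockTriangular_inv_of_blockTriangular (isUpperTri_iff_blockTriangular.1 hM)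

end IsUpperTri

theorem adjugate_eq_det_smul_inv {n : ℕ} {M : MatC n} (hu : IsUnit M) :
    M.adjugate = M.det • M⁻¹ := by
  have hd : M.det ≠ 0 := ((Matrix.isUnit_iff_isUnit_det M).1 hu).ne_zero
  rw [Matrix.inv_def, Ring.inverse_eq_inv', smul_smul, mul_inv_cancel₀ hd, one_smul]

theorem IsUpperTri.adjugate {n : ℕ} {M : MatC n} (hM : IsUpperTri M) (hu : IsUnit M) :
    IsUpperTri M.adjugate := by
  rw [adjugate_eq_det_smul_inv hu]
  exact (hM.inv hu).smul _

/-- The triples `(B₁, B₂, Y)` of matrices, with `B₁` and `B₂` upper triangular, such that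
`P * Y` and `Y * P` are upper triangular. They form a linear space. -/
structure IsStratumParam {n : ℕ} (P B₁ B₂ Y : MatC n) : Prop where
  left : IsUpperTri B₁
  right : IsUpperTri B₂
  mul_upperTri : IsUpperTri (P * Y)
  upperTri_mul : IsUpperTri (Y * P)

theorem IsStratumParam.mem_EP {n : ℕ} {P B₁ B₂ Y : MatC n} (h : IsStratumParam P B₁ B₂ Y)
    (h₁ : IsUnit B₁) (h₂ : IsUnit B₂) :
    (B₁ * P * B₂, B₂.adjugate * Y * B₁.adjugate) ∈ EP P := by
  refine ⟨⟨B₁, B₂, h₁, h.left, h₂, h.right, rfl⟩, ?_, ?_⟩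
  · have : B₁ * P * B₂ * (B₂.adjugate * Y * B₁.adjugate) =
        B₂.det • (B₁ * (P * Y) * B₁.adjugate) := by
      calc _ = B₁ * P * (B₂ * B₂.adjugate) * Y * B₁.adjugate := by simp only [Matrix.mul_assoc]
        _ = _ := by simp [Matrix.mul_adjugate, Matrix.mul_assoc]
    simp only [this]
    exact ((h.left.mul h.mul_upperTri).mul (h.left.adjugate h₁)).smul _
  · have : B₂.adjugate * Y * B₁.adjugate * (B₁ * P * B₂) =
        B₁.det • (B₂.adjugate * (Y * P) * B₂) := by
      calc _ = B₂.adjugate * Y * (B₁.adjugate * B₁) * P * B₂ := by simp only [Matrix.mul_assoc]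
        _ = _ := by simp [Matrix.adjugate_mul, Matrix.mul_assoc]
    simp only [this]
    exact (((h.right.adjugate h₂).mul h.upperTri_mul).mul h.right).smul _

theorem exists_isStratumParam_of_mem_EP {n : ℕ} {P : MatC n} {p : MatC n × MatC n}
    (hp : p ∈ EP P) :
    ∃ B₁ B₂ Y : MatC n, IsUnit B₁ ∧ IsUnit B₂ ∧ IsStratumParam P B₁ B₂ Y ∧
      p = (B₁ * P * B₂, B₂.adjugate * Y * B₁.adjugate) := by
  obtain ⟨X, Z⟩ := p
  obtain ⟨⟨B₁, B₂, h₁, t₁, h₂, t₂, hX⟩, hXZ, hZX⟩ := hp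
  simp only at hX hXZ hZX
  subst hX
  have d₁ := (Matrix.isUnit_iff_isUnit_det B₁).1 h₁
  have d₂ := (Matrix.isUnit_iff_isUnit_det B₂).1 h₂
  have n₁ := d₁.ne_zero
  have n₂ := d₂.ne_zero
  refine ⟨B₁, B₂, (B₁.det * B₂.det)⁻¹ • (B₂ * Z * B₁), h₁, h₂, ⟨t₁, t₂, ?_, ?_⟩, ?_⟩
  · rw [Matrix.mul_smul]
    refine IsUpperTri.smul _ ?_
    have : P * (B₂ * Z * B₁) = B₁⁻¹ * (B₁ * P * B₂ * Z) * B₁ := by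
      simp only [Matrix.mul_assoc, Matrix.nonsing_inv_mul_cancel_left _ _ d₁]
    rw [this]
    exact ((t₁.inv h₁).mul hXZ).mul t₁
  · rw [Matrix.smul_mul]
    refine IsUpperTri.smul _ ?_
    have : B₂ * Z * B₁ * P = B₂ * (Z * (B₁ * P * B₂)) * B₂⁻¹ := by
      simp only [← Matrix.mul_assoc, Matrix.mul_nonsing_inv_cancel_right _ _ d₂]
    rw [this]
    exact (t₂.mul hZX).mul (t₂.inv h₂)
  · congr 1
    have : B₂.adjugate * (B₂ * Z * B₁) * B₁.adjugate =
        (B₂.adjugate * B₂) * Z * (B₁ * B₁.adjugate) := by simp only [Matrix.mul_assoc]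
    rw [Matrix.mul_smul, Matrix.smul_mul, this, Matrix.adjugate_mul, Matrix.mul_adjugate]
    have hdet : (B₁.det * B₂.det)⁻¹ * (B₁.det * B₂.det) = 1 :=
      inv_mul_cancel₀ (mul_ne_zero n₁ n₂)
    simp only [Matrix.smul_mul, Matrix.mul_smul, Matrix.one_mul, Matrix.mul_one, smul_smul,
      hdet, one_smul]

theorem IsStratumParam.lineMap {n : ℕ} {P B₁ B₂ Y C₁ C₂ Z : MatC n}
    (h : IsStratumParam P B₁ B₂ Y) (h' : IsStratumParam P C₁ C₂ Z) (t : ℂ) :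
    IsStratumParam P ((1 - t) • B₁ + t • C₁) ((1 - t) • B₂ + t • C₂) ((1 - t) • Y + t • Z) where
  left := (h.left.smul _).add (h'.left.smul _)
  right := (h.right.smul _).add (h'.right.smul _)
  mul_upperTri := by
    rw [Matrix.mul_add, Matrix.mul_smul, Matrix.mul_smul]
    exact (h.mul_upperTri.smul _).add (h'.mul_upperTri.smul _)
  upperTri_mul := by
    rw [Matrix.add_mul, Matrix.smul_mul, Matrix.smul_mul]
    exact (h.upperTri_mul.smul _).add (h'.upperTri_mul.smul _)

/-- The affine line from `M` to `N`, as a matrix with polynomial entries. -/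
def polyLine {n : ℕ} (M N : MatC n) : Matrix (Fin n) (Fin n) (Polynomial ℂ) :=
  Matrix.of fun i j =>
    (1 - Polynomial.X) * Polynomial.C (M i j) + Polynomial.X * Polynomial.C (N i j)

theorem polyLine_map_eval {n : ℕ} (M N : MatC n) (t : ℂ) :
    (Polynomial.evalRingHom t).mapMatrix (polyLine M N) = (1 - t) • M + t • N := by
  ext i j
  simp [polyLine, -Polynomial.X_mul_C]

/-- Pulling back `f` along a polynomial curve in the space of pairs of matrices. -/
def pullbackCurve {n : ℕ} (A B : Matrix (Fin n) (Fin n) (Polynomial ℂ)) (f : PolyRing n) :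
    Polynomial ℂ :=
  MvPolynomial.aeval (Sum.elim (fun q => A q.1 q.2) (fun q => B q.1 q.2)) f

theorem eval_pullbackCurve {n : ℕ} (A B : Matrix (Fin n) (Fin n) (Polynomial ℂ))
    (f : PolyRing n) (t : ℂ) :
    (pullbackCurve A B f).eval t =
      evalPt n ((Polynomial.evalRingHom t).mapMatrix A, (Polynomial.evalRingHom t).mapMatrix B)
        f := by
  induction f using MvPolynomial.induction_on with
  | C a => simp [pullbackCurve, evalPt]
  | add p q hp hq => simpa [pullbackCurve] using congrArg₂ (· + ·) hp hq
  | mul_X p i hp =>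
    have hi : (pullbackCurve A B (MvPolynomial.X i)).eval t =
        evalPt n ((Polynomial.evalRingHom t).mapMatrix A,
          (Polynomial.evalRingHom t).mapMatrix B) (MvPolynomial.X i) := by
      cases i <;> simp [pullbackCurve, evalPt]
    rw [map_mul, ← hp, ← hi]
    simp [pullbackCurve]

theorem mem_vanishingIdeal_iff {n : ℕ} {S : Set (MatC n × MatC n)} {f : PolyRing n} :
    f ∈ vanishingIdeal n S ↔ ∀ p ∈ S, evalPt n p f = 0 := by
  simp [vanishingIdeal, Submodule.mem_iInf, RingHom.mem_ker]

theorem exists_mem_EP_eval_ne_zero {n : ℕ} {P : MatC n} {p q : MatC n × MatC n}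
    (hp : p ∈ EP P) (hq : q ∈ EP P) {f g : PolyRing n} (hf : evalPt n p f ≠ 0)
    (hg : evalPt n q g ≠ 0) : ∃ r ∈ EP P, evalPt n r (f * g) ≠ 0 := by
  obtain ⟨B₁, B₂, Y, h₁, h₂, h, rfl⟩ := exists_isStratumParam_of_mem_EP hp
  obtain ⟨C₁, C₂, Z, -, -, h', rfl⟩ := exists_isStratumParam_of_mem_EP hq
  set L₁ := polyLine B₁ C₁
  set L₂ := polyLine B₂ C₂
  set A := L₁ * Polynomial.C.mapMatrix P * L₂ with hA
  set D := L₂.adjugate * polyLine Y Z * L₁.adjugate with hD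
  have evalA (t : ℂ) : (Polynomial.evalRingHom t).mapMatrix A =
      ((1 - t) • B₁ + t • C₁) * P * ((1 - t) • B₂ + t • C₂) := by
    have hP : (Polynomial.evalRingHom t).mapMatrix (Polynomial.C.mapMatrix P) = P := by
      ext i j
      simp
    rw [hA, map_mul, map_mul, hP, polyLine_map_eval, polyLine_map_eval]
  have evalD (t : ℂ) : (Polynomial.evalRingHom t).mapMatrix D =
      ((1 - t) • B₂ + t • C₂).adjugate * ((1 - t) • Y + t • Z) *
        ((1 - t) • B₁ + t • C₁).adjugate := by
    rw [hD, map_mul, map_mul, RingHom.map_adjugate, RingHom.map_adjugate, polyLine_map_eval,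
      polyLine_map_eval, polyLine_map_eval]
  have evalDet (M N : MatC n) (t : ℂ) :
      (polyLine M N).det.eval t = ((1 - t) • M + t • N).det := by
    rw [← polyLine_map_eval, ← RingHom.map_det, Polynomial.coe_evalRingHom]
  have det_ne {M : MatC n} (N : MatC n) (hM : IsUnit M) : (polyLine M N).det ≠ 0 := by
    intro h0
    have := evalDet M N 0
    rw [h0] at this
    exact ((Matrix.isUnit_iff_isUnit_det M).1 hM).ne_zero (by simpa using this.symm)
  have hF : pullbackCurve A D f ≠ 0 := by
    intro h0
    have := eval_pullbackCurve A D f 0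
    rw [h0, evalA, evalD] at this
    exact hf (by simpa using this.symm)
  have hG : pullbackCurve A D g ≠ 0 := by
    intro h0
    have := eval_pullbackCurve A D g 1
    rw [h0, evalA, evalD] at this
    exact hg (by simpa using this.symm)
  have hprod := mul_ne_zero (mul_ne_zero hF hG) (mul_ne_zero (det_ne C₁ h₁) (det_ne C₂ h₂))
  obtain ⟨t, ht⟩ : ∃ t, Polynomial.eval t (pullbackCurve A D f * pullbackCurve A D g *
      ((polyLine B₁ C₁).det * (polyLine B₂ C₂).det)) ≠ 0 := by
    by_contra! hall
    exact hprod (Polynomial.funext fun t => by simpa using hall t)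
  simp only [Polynomial.eval_mul, eval_pullbackCurve, evalA, evalD, evalDet] at ht
  obtain ⟨hfg, hdet⟩ := mul_ne_zero_iff.1 ht
  obtain ⟨u₁, u₂⟩ := mul_ne_zero_iff.1 hdet
  refine ⟨_, (h.lineMap h' t).mem_EP ((Matrix.isUnit_iff_isUnit_det _).2 u₁.isUnit)
    ((Matrix.isUnit_iff_isUnit_det _).2 u₂.isUnit), ?_⟩
  rwa [map_mul]

theorem pair_zero_mem_EP {n : ℕ} (P : MatC n) : (P, 0) ∈ EP P :=
  ⟨⟨1, 1, isUnit_one, .one, isUnit_one, .one, by simp⟩,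
    by simpa using IsUpperTri.zero, by simpa using IsUpperTri.zero⟩

/-- For a partial permutation matrix `P`, the stratum `E_P` is irreducible:
its vanishing ideal is prime. -/
theorem stmt18 (n : ℕ) (hn : 1 ≤ n) (P : MatC n) (hP : IsPartialPermMat P) :
    (vanishingIdeal n (EP P)).IsPrime := by
  refine ⟨fun htop => ?_, fun {f g} hfg => ?_⟩
  · have h1 : (1 : PolyRing n) ∈ vanishingIdeal n (EP P) := htop ▸ Submodule.mem_top
    simpa using mem_vanishingIdeal_iff.1 h1 _ (pair_zero_mem_EP P)
  · simp only [mem_vanishingIdeal_iff] at hfg ⊢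
    by_contra! hne
    obtain ⟨⟨p, hp, hf⟩, q, hq, hg⟩ := hne
    obtain ⟨r, hr, hne⟩ := exists_mem_EP_eval_ne_zero hp hq hf hg
    exact hne (hfg r hr)
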